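/- arXiv:1507.01307 — 2 statements merged into one kernel-verified Lean document; each statement's English description precedes it below -/
import Mathlib

section
/- Suppose Jc is nonempty and that max over j ∈ Jc of |⟨a_j, v⟩| < 1 for every dual point v ∈ D0. Then for every b ∈ S0 with b ≠ 0, min over j ∈ J0 of arccos|⟨a_j, b/‖b‖₂⟩| < min over j ∈ Jc of arccos|⟨a_j, b/‖b‖₂⟩| (equivalently, max over j ∈ J0 of |⟨a_j, b⟩| > max over j ∈ Jc of |⟨a_j, b⟩|). -/
open scoped RealInnerProductSpace

noncomputable section

/-- In a compact set, a continuous linear functional is bounded strictly above by any number that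
strictly bounds it at the extreme points. -/
theorem IsCompact.lt_of_forall_extremePoints_lt {E : Type*} [NormedAddCommGroup E]
    [NormedSpace ℝ E] {K : Set E} (hK : IsCompact K) (f : E →L[ℝ] ℝ) {c : ℝ}
    (h : ∀ v ∈ K.extremePoints ℝ, f v < c) {x : E} (hx : x ∈ K) : f x < c := by
  obtain ⟨m, hmK, hm⟩ := hK.exists_isMaxOn ⟨x, hx⟩ f.continuous.continuousOn
  have hexp : IsExposed ℝ K {y ∈ K | ∀ z ∈ K, f z ≤ f y} := fun _ => ⟨f, rfl⟩
  obtain ⟨v, hv⟩ := (hexp.isCompact hK).extremePoints_nonempty ⟨m, hmK, hm⟩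
  exact ((extremePoints_subset hv).2 x hx).trans_lt
    (h v (hexp.isExtreme.extremePoints_subset_extremePoints hv))

/-- A vector in the span of a family that is orthogonal to the whole family vanishes. -/
theorem eq_zero_of_mem_span_of_forall_inner_eq_zero {E ι : Type*} [NormedAddCommGroup E]
    [InnerProductSpace ℝ E] {a : ι → E} {v : E} (hv : v ∈ Submodule.span ℝ (Set.range a))
    (h : ∀ j, ⟪a j, v⟫ = 0) : v = 0 := by
  have key : ∀ w ∈ Submodule.span ℝ (Set.range a), ⟪w, v⟫ = 0 := by
    intro w hw
    induction hw using Submodule.span_induction with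
    | mem w hw => obtain ⟨j, rfl⟩ := hw; exact h j
    | zero => simp
    | add w₁ w₂ _ _ h₁ h₂ => rw [inner_add_left, h₁, h₂, add_zero]
    | smul r w _ hw => rw [real_inner_smul_left, hw, mul_zero]
  exact inner_self_eq_zero.mp (key v hv)

/-- The relative polar set of a finite family is compact. -/
theorem isCompact_relative_polar {E ι : Type*} [NormedAddCommGroup E] [InnerProductSpace ℝ E]
    [FiniteDimensional ℝ E] [Fintype ι] (a : ι → E) :
    IsCompact {v | v ∈ Submodule.span ℝ (Set.range a) ∧ ∀ j, |⟪a j, v⟫| ≤ 1} := by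
  let T : Submodule.span ℝ (Set.range a) →ₗ[ℝ] ι → ℝ :=
    (LinearMap.pi fun j => (innerSL ℝ (a j)).toLinearMap) ∘ₗ Submodule.subtype _
  have hT : ∀ v j, T v j = ⟪a j, (v : E)⟫ := fun _ _ => rfl
  have hker : LinearMap.ker T = ⊥ := by
    refine LinearMap.ker_eq_bot'.mpr fun v hv => Subtype.ext ?_
    exact eq_zero_of_mem_span_of_forall_inner_eq_zero v.2 fun j => by rw [← hT, hv]; rfl
  have hcomp := ((LinearMap.isClosedEmbedding_of_injective hker).isCompact_preimage
    (isCompact_closedBall (0 : ι → ℝ) 1)).image continuous_subtype_val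
  convert hcomp using 1
  ext v
  simp only [Set.mem_image, Set.mem_preimage, mem_closedBall_zero_iff,
    pi_norm_le_iff_of_nonneg zero_le_one, hT, Real.norm_eq_abs, Set.mem_ofPred_eq]
  exact ⟨fun h => ⟨⟨v, h.1⟩, h.2, rfl⟩, by rintro ⟨w, hw, rfl⟩; exact ⟨w.2, hw⟩⟩

/-- If `|⟪c, v⟫| < 1` at every extreme point of the relative polar set of a finite family, then
every nonzero vector of the span correlates more with some member of the family than with `c`. -/
theorem exists_abs_inner_lt_abs_inner {E ι : Type*} [NormedAddCommGroup E]
    [InnerProductSpace ℝ E] [FiniteDimensional ℝ E] [Fintype ι] [Nonempty ι] (a : ι → E) (c : E)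
    (h : ∀ v ∈ Set.extremePoints ℝ
      {v | v ∈ Submodule.span ℝ (Set.range a) ∧ ∀ j, |⟪a j, v⟫| ≤ 1}, |⟪c, v⟫| < 1)
    {x : E} (hx : x ∈ Submodule.span ℝ (Set.range a)) (hx0 : x ≠ 0) :
    ∃ i, |⟪c, x⟫| < |⟪a i, x⟫| := by
  obtain ⟨i, hi⟩ := Finite.exists_max fun j => |⟪a j, x⟫|
  have hpos : 0 < |⟪a i, x⟫| := by
    by_contra! hle
    exact hx0 (eq_zero_of_mem_span_of_forall_inner_eq_zero hx fun j =>
      abs_nonpos_iff.mp ((hi j).trans hle))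
  have hmem : |⟪a i, x⟫|⁻¹ • x ∈
      {v | v ∈ Submodule.span ℝ (Set.range a) ∧ ∀ j, |⟪a j, v⟫| ≤ 1} := by
    refine ⟨Submodule.smul_mem _ _ hx, fun j => ?_⟩
    rw [real_inner_smul_right, abs_mul, abs_inv, abs_abs, inv_mul_le_one₀ hpos]
    exact hi j
  have hK := isCompact_relative_polar a
  have h₁ := hK.lt_of_forall_extremePoints_lt (innerSL ℝ c) (c := 1)
    (fun v hv => (abs_lt.mp (h v hv)).2) hmem
  have h₂ := hK.lt_of_forall_extremePoints_lt (-innerSL ℝ c) (c := 1)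
    (fun v hv => neg_lt.mp (abs_lt.mp (h v hv)).1) hmem
  have h₃ : |⟪c, |⟪a i, x⟫|⁻¹ • x⟫| < 1 := abs_lt.mpr ⟨neg_lt.mp h₂, h₁⟩
  rw [real_inner_smul_right, abs_mul, abs_inv, abs_abs, inv_mul_lt_one₀ hpos] at h₃
  exact ⟨i, h₃⟩

/-- For a dictionary `A = A0 ∪ Ac` of unit vectors (with `A0 = (a0 j)` spanning
`S0`, every atom `ac j` outside `S0`, and `Jc` nonempty), if `|⟪ac j, v⟫| < 1` for every
`j ∈ Jc` and every dual point `v ∈ D0` (the extreme points of the relative polar set of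
`A0`), then for every nonzero `b ∈ S0`:
`min_j arccos |⟪a0 j, b/‖b‖⟫| < min_j arccos |⟪ac j, b/‖b‖⟫|`. -/
theorem stmt_9 {D : ℕ} {ι0 ιc : Type*} [Fintype ι0] [Fintype ιc] [Nonempty ι0] [Nonempty ιc]
    (a0 : ι0 → EuclideanSpace ℝ (Fin D)) (ac : ιc → EuclideanSpace ℝ (Fin D))
    (ha0 : ∀ j, ‖a0 j‖ = 1) (hac : ∀ j, ‖ac j‖ = 1)
    (S0 : Submodule ℝ (EuclideanSpace ℝ (Fin D)))
    (hS0 : S0 = Submodule.span ℝ (Set.range a0))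
    (hout : ∀ j, ac j ∉ S0)
    (D0 : Set (EuclideanSpace ℝ (Fin D)))
    (hD0 : D0 = Set.extremePoints ℝ {v | v ∈ S0 ∧ ∀ j, |⟪a0 j, v⟫| ≤ 1})
    (hsep : ∀ v ∈ D0, ∀ j : ιc, |⟪ac j, v⟫| < 1) :
    ∀ b : EuclideanSpace ℝ (Fin D), b ∈ S0 → b ≠ 0 →
      (⨅ j, Real.arccos |⟪a0 j, ‖b‖⁻¹ • b⟫|) < ⨅ j, Real.arccos |⟪ac j, ‖b‖⁻¹ • b⟫| := by
  intro b hb hb0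
  subst hS0 hD0
  have hn : ‖b‖ ≠ 0 := norm_ne_zero_iff.mpr hb0
  have hx := Submodule.smul_mem _ ‖b‖⁻¹ hb
  have hx0 : ‖b‖⁻¹ • b ≠ 0 := smul_ne_zero (inv_ne_zero hn) hb0
  have hx1 : ‖‖b‖⁻¹ • b‖ = 1 := by rw [norm_smul, norm_inv, norm_norm, inv_mul_cancel₀ hn]
  generalize ‖b‖⁻¹ • b = x at hx hx0 hx1
  obtain ⟨j, hj⟩ := exists_eq_ciInf_of_finite (f := fun j => Real.arccos |⟪ac j, x⟫|)
  obtain ⟨i, hi⟩ := exists_abs_inner_lt_abs_inner a0 (ac j) (fun v hv => hsep v hv j) hx hx0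
  have hle : |⟪a0 i, x⟫| ≤ 1 := by
    simpa [ha0 i, hx1] using abs_real_inner_le_norm (a0 i) x
  rw [← hj]
  exact (ciInf_le (Set.finite_range _).bddBelow i).trans_lt
    (Real.arccos_lt_arccos (neg_one_lt_zero.le.trans (abs_nonneg _)) hi hle)
end
end

section
/- For every integer p ≥ 2 and every ε with 0 < ε ≤ π/4, there exists a finite set V ⊆ S^{p−1} with card(V) ≤ p·v_p/(v_{p−1}·sin^{p−1}(ε/2)) such that every point of S^{p−1} is within spherical distance ε of some point of V (i.e., the covering number of S^{p−1} at scale ε in the spherical metric is at most p·v_p/(v_{p−1}·sin^{p−1}(ε/2))). -/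
open scoped RealInnerProductSpace

noncomputable section

/-- `vball p` is the Lebesgue volume `v_p = π^(p/2) / Γ(p/2 + 1)` of the unit ball of
`ℝ^p`. -/
def vball (p : ℕ) : ℝ := Real.pi ^ ((p : ℝ) / 2) / Real.Gamma ((p : ℝ) / 2 + 1)

open MeasureTheory InnerProductGeometry

theorem volume_real_unitBall (n : ℕ) (hn : 1 ≤ n) :
    volume.real (Metric.ball (0 : EuclideanSpace ℝ (Fin n)) 1) = vball n := by
  have : Nonempty (Fin n) := ⟨⟨0, hn⟩⟩
  have hΓ : 0 < Real.Gamma ((n : ℝ) / 2 + 1) := Real.Gamma_pos_of_pos (by positivity)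
  rw [measureReal_def, EuclideanSpace.volume_ball]
  simp only [Fintype.card_fin, ENNReal.ofReal_one, one_pow, one_mul]
  rw [ENNReal.toReal_ofReal (by positivity), vball, Real.sqrt_eq_rpow, ← Real.rpow_natCast,
    ← Real.rpow_mul Real.pi_pos.le]
  congr 2
  ring

theorem vball_pos (n : ℕ) : 0 < vball n := by
  have hΓ : 0 < Real.Gamma ((n : ℝ) / 2 + 1) := Real.Gamma_pos_of_pos (by positivity)
  unfold vball
  positivity

/-- The volume of a solid of revolution around the first axis of `ℝ × ℝ^n`. -/
theorem volume_solidOfRevolution (n : ℕ) (hn : 1 ≤ n) {a b : ℝ} (hab : a ≤ b) {f : ℝ → ℝ}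
    (hf : Continuous f) (hf0 : ∀ t ∈ Set.Ioo a b, 0 ≤ f t) :
    volume {q : ℝ × EuclideanSpace ℝ (Fin n) | q.1 ∈ Set.Ioo a b ∧ ‖q.2‖ < f q.1} =
      ENNReal.ofReal ((∫ t in a..b, f t ^ n) * vball n) := by
  have : Nonempty (Fin n) := ⟨⟨0, hn⟩⟩
  have hmeas : MeasurableSet
      {q : ℝ × EuclideanSpace ℝ (Fin n) | q.1 ∈ Set.Ioo a b ∧ ‖q.2‖ < f q.1} :=
    (measurable_fst measurableSet_Ioo).inter
      (measurableSet_lt measurable_snd.norm (hf.measurable.comp measurable_fst))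
  have hslice (t : ℝ) :
      volume (Prod.mk t ⁻¹'
        {q : ℝ × EuclideanSpace ℝ (Fin n) | q.1 ∈ Set.Ioo a b ∧ ‖q.2‖ < f q.1}) =
      (Set.Ioo a b).indicator (fun t => ENNReal.ofReal (f t ^ n * vball n)) t := by
    by_cases ht : t ∈ Set.Ioo a b
    · have : Prod.mk t ⁻¹'
          {q : ℝ × EuclideanSpace ℝ (Fin n) | q.1 ∈ Set.Ioo a b ∧ ‖q.2‖ < f q.1} =
          Metric.ball 0 (f t) := by
        ext y
        simp [ht.1, ht.2]
      rw [this, Set.indicator_of_mem ht, Measure.addHaar_ball _ _ (hf0 t ht),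
        finrank_euclideanSpace, Fintype.card_fin, ← volume_real_unitBall n hn,
        ENNReal.ofReal_mul (pow_nonneg (hf0 t ht) n),
        ofReal_measureReal measure_ball_lt_top.ne]
    · have : Prod.mk t ⁻¹'
          {q : ℝ × EuclideanSpace ℝ (Fin n) | q.1 ∈ Set.Ioo a b ∧ ‖q.2‖ < f q.1} = ∅ := by
        ext y
        simpa using fun h1 h2 => (ht ⟨h1, h2⟩).elim
      rw [this, Set.indicator_of_notMem ht, measure_empty]
  have hcont : Continuous fun t => f t ^ n * vball n := by fun_prop
  rw [Measure.volume_eq_prod, Measure.prod_apply hmeas]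
  simp_rw [hslice]
  rw [lintegral_indicator measurableSet_Ioo, ← ofReal_integral_eq_lintegral_ofReal,
    ← integral_Ioc_eq_integral_Ioo, ← intervalIntegral.integral_of_le hab,
    intervalIntegral.integral_mul_const]
  · exact (hcont.integrableOn_Icc (a := a) (b := b)).mono_set Set.Ioo_subset_Icc_self
  · filter_upwards [ae_restrict_mem measurableSet_Ioo] with t ht
    exact mul_nonneg (pow_nonneg (hf0 t ht) n) (vball_pos n).le

/-- The part of the open unit ball within angle `α` of `v`. -/
def ballSector {E : Type*} [NormedAddCommGroup E] [InnerProductSpace ℝ E] (v : E) (α : ℝ) :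
    Set E :=
  {x | ‖x‖ < 1 ∧ ‖x‖ * Real.cos α < ⟪v, x⟫}

theorem isOpen_ballSector {E : Type*} [NormedAddCommGroup E] [InnerProductSpace ℝ E]
    (v : E) (α : ℝ) : IsOpen (ballSector v α) :=
  (isOpen_lt continuous_norm continuous_const).inter
    (isOpen_lt (continuous_norm.mul continuous_const) (continuous_const.inner continuous_id))

theorem angle_lt_of_mem_ballSector {E : Type*} [NormedAddCommGroup E] [InnerProductSpace ℝ E]
    {v x : E} {α : ℝ} (hv : ‖v‖ = 1) (hα : 0 ≤ α) (hx : x ∈ ballSector v α) :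
    angle v x < α := by
  have hx0 : x ≠ 0 := by
    rintro rfl
    simpa using hx.2
  by_contra! h
  have h1 := Real.cos_le_cos_of_nonneg_of_le_pi hα (angle_le_pi v x) h
  have h2 := hx.2
  rw [← cos_angle_mul_norm_mul_norm v x, hv, one_mul, mul_comm] at h2
  exact absurd (lt_of_mul_lt_mul_right h2 (norm_nonneg x)) h1.not_gt

/-- Splitting off the first coordinate along a unit vector. -/
theorem exists_measurePreserving_prod (n : ℕ) {v : EuclideanSpace ℝ (Fin (n + 1))}
    (hv : ‖v‖ = 1) :
    ∃ Φ : ℝ × EuclideanSpace ℝ (Fin n) → EuclideanSpace ℝ (Fin (n + 1)),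
      MeasurePreserving Φ ∧ ∀ q, ⟪v, Φ q⟫ = q.1 ∧ ‖Φ q‖ ^ 2 = q.1 ^ 2 + ‖q.2‖ ^ 2 := by
  obtain ⟨b, hb⟩ := Orthonormal.exists_orthonormalBasis_extension_of_card_eq
    (𝕜 := ℝ) (ι := Fin (n + 1)) (by simp) (v := fun _ => v) (s := {0})
    (by
      rw [orthonormal_iff_ite]
      rintro ⟨i, rfl⟩ ⟨j, rfl⟩
      simp [hv])
  have hb0 : b 0 = v := hb 0 rfl
  have h := (b.measurePreserving_repr_symm.comp
    (PiLp.volume_preserving_toLp (Fin (n + 1)))).comp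
    ((volume_preserving_piFinSuccAbove (fun _ : Fin (n + 1) => ℝ) 0).symm.comp
      ((MeasurePreserving.id volume).prod (PiLp.volume_preserving_ofLp (Fin n))))
  refine ⟨_, h, fun q => ⟨?_, ?_⟩⟩
  · rw [← hb0, ← b.repr_apply_apply]
    simp
  · simp [EuclideanSpace.norm_sq_eq, Fin.sum_univ_succ]


theorem volume_ballSector_ge (n : ℕ) (hn : 1 ≤ n) {v : EuclideanSpace ℝ (Fin (n + 1))}
    (hv : ‖v‖ = 1) {α : ℝ} (hα : 0 < α) (hα' : α < Real.pi / 2) :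
    ENNReal.ofReal (Real.sin α ^ n * vball n / (n + 1)) ≤ volume (ballSector v α) := by
  obtain ⟨Φ, hΦ, hΦv⟩ := exists_measurePreserving_prod n hv
  have hc : 0 < Real.cos α := Real.cos_pos_of_mem_Ioo ⟨by linarith, hα'⟩
  have hs : 0 < Real.sin α := Real.sin_pos_of_pos_of_lt_pi hα (by linarith)
  have hsc := Real.sin_sq_add_cos_sq α
  set c := Real.cos α
  set s := Real.sin α
  have hc1 : c < 1 := by nlinarith
  have h1c : 0 < 1 - c := by linarith
  have hlow := volume_solidOfRevolution n hn hc.le (f := fun t => s / c * t) (by fun_prop)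
    fun t ht => mul_nonneg (by positivity) ht.1.le
  have hupp := volume_solidOfRevolution n hn hc1.le (f := fun t => s / (1 - c) * (1 - t))
    (by fun_prop) fun t ht => mul_nonneg (by positivity) (by linarith [ht.2])
  have hlowint : ∫ t in (0)..c, (s / c * t) ^ n = s ^ n * c / (n + 1) := by
    simp_rw [mul_pow]
    rw [intervalIntegral.integral_const_mul, integral_pow]
    field_simp
    simp only [div_pow, pow_succ]
    field_simp
    ring
  have huppint : ∫ t in c..1, (s / (1 - c) * (1 - t)) ^ n = s ^ n * (1 - c) / (n + 1) := by
    simp_rw [mul_pow]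
    rw [intervalIntegral.integral_const_mul,
      intervalIntegral.integral_comp_sub_left (fun t => t ^ n) 1, integral_pow]
    field_simp
    simp only [sub_self, div_pow, pow_succ]
    field_simp
    ring
  rw [hlowint] at hlow
  rw [huppint] at hupp
  set A := {q : ℝ × EuclideanSpace ℝ (Fin n) | q.1 ∈ Set.Ioo 0 c ∧ ‖q.2‖ < s / c * q.1}
  set B := {q : ℝ × EuclideanSpace ℝ (Fin n) |
    q.1 ∈ Set.Ioo c 1 ∧ ‖q.2‖ < s / (1 - c) * (1 - q.1)}
  have hBm : MeasurableSet B :=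
    (measurable_fst measurableSet_Ioo).inter
      (measurableSet_lt measurable_snd.norm
        (measurable_const.mul (measurable_const.sub measurable_fst)))
  have hAB : Disjoint A B :=
    Set.disjoint_left.2 fun q hqA hqB => hqA.1.2.not_gt hqB.1.1
  have hmem (q : ℝ × EuclideanSpace ℝ (Fin n)) (hq0 : 0 < q.1)
      (h1 : q.1 ^ 2 + ‖q.2‖ ^ 2 < 1) (h2 : ‖q.2‖ * c < s * q.1) : Φ q ∈ ballSector v α := by
    obtain ⟨hin, hno⟩ := hΦv q
    refine ⟨?_, ?_⟩
    · rw [← hno] at h1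
      exact (sq_lt_one_iff₀ (norm_nonneg _)).1 h1
    · rw [hin]
      refine lt_of_pow_lt_pow_left₀ 2 hq0.le ?_
      have h3 : (‖q.2‖ * c) ^ 2 < (s * q.1) ^ 2 := by gcongr
      rw [mul_pow, hno]
      nlinarith
  have hsub : A ∪ B ⊆ Φ ⁻¹' ballSector v α := by
    rintro q (⟨⟨h0, h1⟩, h2⟩ | ⟨⟨h0, h1⟩, h2⟩)
    · have h3 : ‖q.2‖ * c < s * q.1 := by
        rw [div_mul_eq_mul_div, lt_div_iff₀ hc] at h2
        exact h2
      refine hmem q h0 ?_ h3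
      have h4 : (‖q.2‖ * c) ^ 2 < (s * q.1) ^ 2 := by gcongr
      have h5 : q.1 ^ 2 < c ^ 2 := by gcongr
      have h6 : c ^ 2 * (q.1 ^ 2 + ‖q.2‖ ^ 2) < c ^ 2 * 1 := by nlinarith
      exact lt_of_mul_lt_mul_left h6 (by positivity)
    · have h3 : ‖q.2‖ * (1 - c) < s * (1 - q.1) := by
        rw [div_mul_eq_mul_div, lt_div_iff₀ h1c] at h2
        exact h2
      have hq0 : 0 < q.1 := hc.trans h0
      refine hmem q hq0 ?_ ?_
      · have h4 : (‖q.2‖ * (1 - c)) ^ 2 < (s * (1 - q.1)) ^ 2 := by gcongr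
        have h5 : s ^ 2 = (1 - c) * (1 + c) := by linarith
        have h6 : (1 - c) * (‖q.2‖ ^ 2 * (1 - c)) < (1 - c) * ((1 + c) * (1 - q.1) ^ 2) := by
          rw [mul_pow, mul_pow, h5] at h4
          linarith
        have h7 := lt_of_mul_lt_mul_left h6 h1c.le
        have h8 : (1 - q.1) * ((1 + c) * (1 - q.1)) ≤ (1 - q.1) * ((1 - c) * (1 + q.1)) :=
          mul_le_mul_of_nonneg_left (by linarith) (by linarith)
        have h9 : (1 - c) * (q.1 ^ 2 + ‖q.2‖ ^ 2) < (1 - c) * 1 := by linarith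
        exact lt_of_mul_lt_mul_left h9 h1c.le
      · have h4 : (1 - c) * (‖q.2‖ * c) < (1 - c) * (s * q.1) := by
          have h5 : c * (‖q.2‖ * (1 - c)) < c * (s * (1 - q.1)) := by gcongr
          have h6 : s * c < s * q.1 := by gcongr
          linarith
        exact lt_of_mul_lt_mul_left h4 h1c.le
  have hvb := vball_pos n
  calc ENNReal.ofReal (s ^ n * vball n / (n + 1))
      = volume A + volume B := by
        rw [hlow, hupp, ← ENNReal.ofReal_add (by positivity) (by positivity)]
        congr 1
        ring
    _ = volume (A ∪ B) := (measure_union hAB hBm).symm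
    _ ≤ volume (Φ ⁻¹' ballSector v α) := measure_mono hsub
    _ = volume (ballSector v α) :=
        hΦ.measure_preimage (isOpen_ballSector v α).measurableSet.nullMeasurableSet

/-- Volume bound for sets of unit vectors at pairwise angles at least `2 * α`. -/
theorem card_le_of_pairwise_le_angle (n : ℕ) (hn : 1 ≤ n) {α : ℝ} (hα : 0 < α)
    (hα' : α < Real.pi / 2) (V : Finset (EuclideanSpace ℝ (Fin (n + 1))))
    (hV : ∀ v ∈ V, ‖v‖ = 1)
    (hsep : (V : Set (EuclideanSpace ℝ (Fin (n + 1)))).Pairwise fun v w => 2 * α ≤ angle v w) :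
    (V.card : ℝ) ≤ (n + 1) * vball (n + 1) / (vball n * Real.sin α ^ n) := by
  have hs : 0 < Real.sin α := Real.sin_pos_of_pos_of_lt_pi hα (by linarith [Real.pi_pos])
  have hvb := vball_pos n
  have hdisj : (V : Set (EuclideanSpace ℝ (Fin (n + 1)))).PairwiseDisjoint
      (fun v => ballSector v α) := by
    intro v hv w hw hvw
    refine Set.disjoint_left.2 fun x hxv hxw => ?_
    have h1 := angle_lt_of_mem_ballSector (hV v hv) hα.le hxv
    have h2 := angle_lt_of_mem_ballSector (hV w hw) hα.le hxw
    have h3 := angle_le_angle_add_angle v x w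
    rw [angle_comm x w] at h3
    linarith [hsep hv hw hvw]
  have key : ENNReal.ofReal (V.card * (Real.sin α ^ n * vball n / (n + 1))) ≤
      ENNReal.ofReal (vball (n + 1)) := by
    calc ENNReal.ofReal (V.card * (Real.sin α ^ n * vball n / (n + 1)))
        = ∑ _v ∈ V, ENNReal.ofReal (Real.sin α ^ n * vball n / (n + 1)) := by
          rw [ENNReal.ofReal_mul (by positivity)]
          simp
      _ ≤ ∑ v ∈ V, volume (ballSector v α) :=
          Finset.sum_le_sum fun v hv => volume_ballSector_ge n hn (hV v hv) hα hα'
      _ = volume (⋃ v ∈ V, ballSector v α) :=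
          (measure_biUnion_finset hdisj fun v _ => (isOpen_ballSector v α).measurableSet).symm
      _ ≤ volume (Metric.ball (0 : EuclideanSpace ℝ (Fin (n + 1))) 1) :=
          measure_mono (Set.iUnion₂_subset fun v _ x hx => mem_ball_zero_iff.2 hx.1)
      _ = ENNReal.ofReal (vball (n + 1)) := by
          rw [← volume_real_unitBall (n + 1) (by omega),
            ofReal_measureReal measure_ball_lt_top.ne]
  rw [ENNReal.ofReal_le_ofReal_iff (vball_pos _).le] at key
  rw [le_div_iff₀ (by positivity)]
  rw [← mul_div_assoc, div_le_iff₀ (by positivity)] at key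
  linarith

/-- A separated set of maximal cardinality is a covering. -/
theorem exists_separated_covering {X : Type*} (S : Set X) (d : X → X → ℝ)
    (hd : ∀ x y, d x y = d y x) {ε : ℝ} (hself : ∀ x ∈ S, d x x ≤ ε) (N : ℕ)
    (hN : ∀ V : Finset X, (V : Set X) ⊆ S → (V : Set X).Pairwise (fun x y => ε ≤ d x y) →
      V.card ≤ N) :
    ∃ V : Finset X, (V : Set X) ⊆ S ∧ (V : Set X).Pairwise (fun x y => ε ≤ d x y) ∧
      ∀ w ∈ S, ∃ v ∈ V, d v w ≤ ε := by
  classical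
  let P (k : ℕ) : Prop := ∃ V : Finset X, (V : Set X) ⊆ S ∧
    (V : Set X).Pairwise (fun x y => ε ≤ d x y) ∧ V.card = k
  have hP0 : P 0 := ⟨∅, by simp, by simp, rfl⟩
  obtain ⟨V, hVS, hV, hcard⟩ := Nat.findGreatest_spec (P := P) (Nat.zero_le N) hP0
  refine ⟨V, hVS, hV, fun w hw => ?_⟩
  by_contra! hfar
  have hwV : w ∉ V := fun h => (hfar w h).not_ge (hself w hw)
  have hsub : ((insert w V : Finset X) : Set X) ⊆ S := by
    rw [Finset.coe_insert]
    exact Set.insert_subset hw hVS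
  have hsep : ((insert w V : Finset X) : Set X).Pairwise (fun x y => ε ≤ d x y) := by
    rw [Finset.coe_insert]
    exact hV.insert fun v hv _ => ⟨hd w v ▸ (hfar v hv).le, (hfar v hv).le⟩
  have := Nat.le_findGreatest (P := P) (hN _ hsub hsep) ⟨_, hsub, hsep, rfl⟩
  rw [Finset.card_insert_of_notMem hwV] at this
  omega

/-- For `p ≥ 2` and `0 < ε ≤ π/4`, there is a finite set `V` of unit vectors
of `ℝ^p` of cardinality at most `p·v_p / (v_{p−1}·sin^{p−1}(ε/2))` such that every point of
the unit sphere is within spherical distance `ε` of some point of `V`. -/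
theorem stmt_13 (p : ℕ) (hp : 2 ≤ p) (ε : ℝ) (hε : 0 < ε) (hε' : ε ≤ Real.pi / 4) :
    ∃ V : Finset (EuclideanSpace ℝ (Fin p)),
      (∀ v ∈ V, ‖v‖ = 1) ∧
      (V.card : ℝ) ≤ p * vball p / (vball (p - 1) * Real.sin (ε / 2) ^ (p - 1)) ∧
      ∀ w : EuclideanSpace ℝ (Fin p), ‖w‖ = 1 →
        ∃ v ∈ V, Real.arccos ⟪v, w⟫ ≤ ε := by
  obtain ⟨n, rfl⟩ : ∃ n, p = n + 1 := ⟨p - 1, by omega⟩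
  have hbound := card_le_of_pairwise_le_angle n (by omega) (α := ε / 2) (by linarith)
    (by linarith [Real.pi_pos])
  simp only [mul_div_cancel₀ ε (two_ne_zero' ℝ)] at hbound
  obtain ⟨V, hV1, hVsep, hVcov⟩ := exists_separated_covering
    {v : EuclideanSpace ℝ (Fin (n + 1)) | ‖v‖ = 1} angle angle_comm (ε := ε)
    (fun x hx => by
      rw [angle_self (norm_ne_zero_iff.1 (by rw [hx]; exact one_ne_zero))]
      exact hε.le)
    ⌊(n + 1) * vball (n + 1) / (vball n * Real.sin (ε / 2) ^ n)⌋₊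
    (fun V hV hsep => Nat.le_floor (hbound V (fun v hv => hV hv) hsep))
  refine ⟨V, fun v hv => hV1 hv, ?_, fun w hw => ?_⟩
  · simpa using hbound V (fun v hv => hV1 hv) hVsep
  · obtain ⟨v, hv, hvw⟩ := hVcov w hw
    refine ⟨v, hv, ?_⟩
    have hv1 : ‖v‖ = 1 := hV1 hv
    simpa [angle, hw, hv1] using hvw
end
end
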